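/- arXiv:1905.01117 — 2 statements merged into one kernel-verified Lean document; each statement's English description precedes it below -/
import Mathlib

section
/- Let 0 < b < ∞ and let 𝓗, P₁, P₀ be as in the standing port-Hamiltonian assumptions on I = (0, b). Define A : D(A) ⊆ L²_𝓗(0, b) → L²_𝓗(0, b) by Ax = P₁(𝓗x)' + P₀𝓗x with D(A) = {x ∈ L²_𝓗(0, b) : (𝓗x)' ∈ L²_𝓗(0, b) and (𝓗x)(0) = (𝓗x)(b) = 0}. Then A is densely defined and closed, and its adjoint (with respect to the inner product of L²_𝓗(0, b)) is A*x = −P₁(𝓗x)' − P₀𝓗x with D(A*) = {x ∈ L²_𝓗(0, b) : (𝓗x)' ∈ L²_𝓗(0, b)}. -/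
open MeasureTheory Matrix

/-- The (possibly infinite / junk-valued) weighted inner product
`⟨x, y⟩_{L²_𝓗(I)} = ∫_I x(ξ)* 𝓗(ξ) y(ξ) dξ` of two `ℂ^d`-valued functions. -/
noncomputable def wip (d : ℕ) (𝓗 : ℝ → Matrix (Fin d) (Fin d) ℂ) (I : Set ℝ)
    (x y : ℝ → Fin d → ℂ) : ℂ :=
  ∫ ξ in I, star (x ξ) ⬝ᵥ ((𝓗 ξ) *ᵥ (y ξ))

/-- Membership in the weighted space `L²_𝓗(I)`: `x` is a.e. measurable on `I` and
`∫_I x(ξ)* 𝓗(ξ) x(ξ) dξ < ∞`. -/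
def MemL2w (d : ℕ) (𝓗 : ℝ → Matrix (Fin d) (Fin d) ℂ) (I : Set ℝ)
    (x : ℝ → Fin d → ℂ) : Prop :=
  AEStronglyMeasurable x (volume.restrict I) ∧
    Integrable (fun ξ => (star (x ξ) ⬝ᵥ ((𝓗 ξ) *ᵥ (x ξ))).re) (volume.restrict I)

/-- `u` is the locally absolutely continuous representative of `𝓗x` on `[0, b]`
(it is the indefinite integral of `g`, the a.e. derivative `(𝓗x)'`), with `g ∈ L²_𝓗(0, b)`. -/
def RepOn (d : ℕ) (𝓗 : ℝ → Matrix (Fin d) (Fin d) ℂ) (b : ℝ)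
    (x u g : ℝ → Fin d → ℂ) : Prop :=
  (∀ᵐ ξ ∂(volume.restrict (Set.Ioo 0 b)), u ξ = (𝓗 ξ) *ᵥ (x ξ)) ∧
    (∀ ξ ∈ Set.Icc (0 : ℝ) b, u ξ = u 0 + ∫ τ in (0 : ℝ)..ξ, g τ) ∧
    MemL2w d 𝓗 (Set.Ioo 0 b) g

/-- The graph of the minimal port-Hamiltonian operator `A x = P₁ (𝓗x)' + P₀ 𝓗x` with
domain `{x ∈ L²_𝓗(0,b) : (𝓗x)' ∈ L²_𝓗(0,b), (𝓗x)(0) = (𝓗x)(b) = 0}`, described as a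
relation (up to a.e. equality) on functions. -/
def GraphA10 (d : ℕ) (𝓗 : ℝ → Matrix (Fin d) (Fin d) ℂ)
    (P1 P0 : Matrix (Fin d) (Fin d) ℂ) (b : ℝ) (x y : ℝ → Fin d → ℂ) : Prop :=
  MemL2w d 𝓗 (Set.Ioo 0 b) x ∧ MemL2w d 𝓗 (Set.Ioo 0 b) y ∧
    ∃ u g, RepOn d 𝓗 b x u g ∧ u 0 = 0 ∧ u b = 0 ∧
      (∀ᵐ ξ ∂(volume.restrict (Set.Ioo 0 b)), y ξ = P1 *ᵥ (g ξ) + P0 *ᵥ (u ξ))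

theorem AbsolutelyContinuousOnInterval.const {F : Type*} [NormedAddCommGroup F] (c : F)
    (a b : ℝ) : AbsolutelyContinuousOnInterval (fun _ : ℝ => c) a b :=
  (LipschitzWith.const c).lipschitzOnWith.absolutelyContinuousOnInterval

theorem IntervalIntegrable.absolutelyContinuousOnInterval_integral_complex {f : ℝ → ℂ}
    {a b c : ℝ} (h : IntervalIntegrable f volume a b) (hc : c ∈ Set.uIcc a b) :
    AbsolutelyContinuousOnInterval (fun x => ∫ v in c..x, f v) a b := by
  have hre : IntervalIntegrable (fun x => (f x).re) volume a b := ⟨h.1.re, h.2.re⟩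
  have him : IntervalIntegrable (fun x => (f x).im) volume a b := ⟨h.1.im, h.2.im⟩
  have key := ((hre.absolutelyContinuousOnInterval_intervalIntegral hc).fun_smul
    (AbsolutelyContinuousOnInterval.const (1 : ℂ) a b)).fun_add
    ((him.absolutelyContinuousOnInterval_intervalIntegral hc).fun_smul
    (AbsolutelyContinuousOnInterval.const Complex.I a b))
  have e : ∀ x ∈ Set.uIcc a b, (∫ v in c..x, f v)
      = (∫ v in c..x, (f v).re) • (1 : ℂ) + (∫ v in c..x, (f v).im) • Complex.I := by
    intro x hx
    have hsub : Set.uIcc c x ⊆ Set.uIcc a b := Set.uIcc_subset_uIcc hc hx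
    have hre' := hre.mono_set hsub
    have him' := him.mono_set hsub
    simp only [Complex.real_smul, mul_one]
    rw [← intervalIntegral.integral_ofReal, ← intervalIntegral.integral_ofReal,
      ← intervalIntegral.integral_mul_const, ← intervalIntegral.integral_add]
    · simp only [Complex.re_add_im]
    · exact ⟨hre'.1.ofReal, hre'.2.ofReal⟩
    · exact ⟨him'.1.ofReal.mul_const _, him'.2.ofReal.mul_const _⟩
  rw [absolutelyContinuousOnInterval_iff] at key ⊢
  intro ε hε
  obtain ⟨δ, hδ, H⟩ := key ε hε
  refine ⟨δ, hδ, fun E hE hs => ?_⟩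
  refine (Finset.sum_congr rfl fun i hi => ?_).trans_lt (H E hE hs)
  have hi' := hE.1 i hi
  rw [e _ hi'.1, e _ hi'.2]

theorem integral_add_mul_of_eq_integral {b : ℝ} (hb : 0 < b) {p q p' q' : ℝ → ℂ}
    (hp' : IntegrableOn p' (Set.Ioo 0 b)) (hq' : IntegrableOn q' (Set.Ioo 0 b))
    (hp : ∀ ξ ∈ Set.Icc 0 b, p ξ = p 0 + ∫ τ in (0 : ℝ)..ξ, p' τ)
    (hq : ∀ ξ ∈ Set.Icc 0 b, q ξ = q 0 + ∫ τ in (0 : ℝ)..ξ, q' τ) :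
    ∫ ξ in Set.Ioo 0 b, (p' ξ * q ξ + p ξ * q' ξ) = p b * q b - p 0 * q 0 := by
  have ip : IntervalIntegrable p' volume 0 b :=
    (intervalIntegrable_iff_integrableOn_Ioo_of_le hb.le).2 hp'
  have iq : IntervalIntegrable q' volume 0 b :=
    (intervalIntegrable_iff_integrableOn_Ioo_of_le hb.le).2 hq'
  set P : ℝ → ℂ := fun ξ => p 0 + ∫ τ in (0 : ℝ)..ξ, p' τ with hP
  set Q : ℝ → ℂ := fun ξ => q 0 + ∫ τ in (0 : ℝ)..ξ, q' τ with hQ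
  have acP : AbsolutelyContinuousOnInterval P 0 b :=
    (AbsolutelyContinuousOnInterval.const _ 0 b).add
      (ip.absolutelyContinuousOnInterval_integral_complex (by simp))
  have acQ : AbsolutelyContinuousOnInterval Q 0 b :=
    (AbsolutelyContinuousOnInterval.const _ 0 b).add
      (iq.absolutelyContinuousOnInterval_integral_complex (by simp))
  have iD : IntervalIntegrable (fun ξ => p' ξ * Q ξ + P ξ * q' ξ) volume 0 b :=
    (ip.mul_continuousOn acQ.continuousOn).add (iq.continuousOn_mul acP.continuousOn)
  have acD := (acP.smul acQ).sub
    (iD.absolutelyContinuousOnInterval_integral_complex (c := 0) (by simp))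
  obtain ⟨C, hC⟩ := acD.const_of_ae_hasDerivAt_zero (by
    filter_upwards [ip.ae_hasDerivAt_integral, iq.ae_hasDerivAt_integral,
      iD.ae_hasDerivAt_integral] with ξ h1 h2 h3 hξ
    have k1 := (h1 hξ 0 (by simp)).const_add (p 0)
    have k2 := (h2 hξ 0 (by simp)).const_add (q 0)
    convert! (k1.mul k2).sub (h3 hξ 0 (by simp)) using 1
    simp [hP, hQ])
  have e0 := hC 0 (by simp)
  have eb := hC b (by simp)
  simp only [Pi.sub_apply, Pi.mul_apply, smul_eq_mul, intervalIntegral.integral_same,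
    sub_zero] at e0 eb
  rw [show P 0 = p 0 by simp [hP], show Q 0 = q 0 by simp [hQ]] at e0
  rw [show P b = p b from (hp b ⟨hb.le, le_rfl⟩).symm,
    show Q b = q b from (hq b ⟨hb.le, le_rfl⟩).symm] at eb
  have : ∫ ξ in Set.Ioo 0 b, (p' ξ * q ξ + p ξ * q' ξ)
      = ∫ ξ in (0 : ℝ)..b, (p' ξ * Q ξ + P ξ * q' ξ) := by
    rw [intervalIntegral.integral_of_le hb.le, integral_Ioc_eq_integral_Ioo]
    refine setIntegral_congr_fun measurableSet_Ioo fun ξ hξ => ?_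
    simp only [hP, hQ]
    rw [← hp ξ (Set.Ioo_subset_Icc_self hξ), ← hq ξ (Set.Ioo_subset_Icc_self hξ)]
  rw [this]
  linear_combination e0 - eb

section Pointwise

variable {d : ℕ}

theorem re_star_dotProduct_self (ζ : Fin d → ℂ) :
    (star ζ ⬝ᵥ ζ).re = ∑ i, ‖ζ i‖ ^ 2 := by
  simp [dotProduct, Complex.sq_norm, Complex.normSq_apply]

theorem sq_norm_le_re_star_dotProduct (ζ : Fin d → ℂ) : ‖ζ‖ ^ 2 ≤ (star ζ ⬝ᵥ ζ).re := by
  rw [re_star_dotProduct_self]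
  have h0 : 0 ≤ ∑ i, ‖ζ i‖ ^ 2 := by positivity
  rw [← Real.le_sqrt (norm_nonneg _) h0]
  refine (pi_norm_le_iff_of_nonneg (Real.sqrt_nonneg _)).2 fun i => ?_
  rw [Real.le_sqrt (norm_nonneg _) h0]
  exact Finset.single_le_sum (f := fun i => ‖ζ i‖ ^ 2) (fun i _ => by positivity)
    (Finset.mem_univ i)

theorem re_star_dotProduct_le (ζ : Fin d → ℂ) : (star ζ ⬝ᵥ ζ).re ≤ d * ‖ζ‖ ^ 2 := by
  rw [re_star_dotProduct_self]
  calc ∑ i, ‖ζ i‖ ^ 2 ≤ ∑ _i : Fin d, ‖ζ‖ ^ 2 := by gcongr with i; exact norm_le_pi_norm ζ i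
    _ = d * ‖ζ‖ ^ 2 := by simp

theorem star_mulVec_dotProduct (A : Matrix (Fin d) (Fin d) ℂ) (ζ η : Fin d → ℂ) :
    star (A *ᵥ ζ) ⬝ᵥ η = star ζ ⬝ᵥ (Aᴴ *ᵥ η) := by
  rw [star_mulVec, dotProduct_mulVec]

theorem re_star_dotProduct_comm (ζ η : Fin d → ℂ) : (star ζ ⬝ᵥ η).re = (star η ⬝ᵥ ζ).re := by
  simp only [dotProduct, Complex.re_sum, Pi.star_apply, RCLike.star_def, Complex.mul_re,
    Complex.conj_re, Complex.conj_im]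
  exact Finset.sum_congr rfl fun i _ => by ring

/-- A Hermitian matrix whose quadratic form lies between `m` and `M` times the squared norm. -/
structure FormBounded (m M : ℝ) (A : Matrix (Fin d) (Fin d) ℂ) : Prop where
  herm : A.IsHermitian
  bound : ∀ ζ : Fin d → ℂ, m * (star ζ ⬝ᵥ ζ).re ≤ (star ζ ⬝ᵥ (A *ᵥ ζ)).re ∧
    (star ζ ⬝ᵥ (A *ᵥ ζ)).re ≤ M * (star ζ ⬝ᵥ ζ).re

variable {m M : ℝ} {A : Matrix (Fin d) (Fin d) ℂ}

theorem FormBounded.re_form_sub_smul (h : FormBounded m M A) (ζ : Fin d → ℂ) (t : ℝ) :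
    (star (ζ - (t : ℂ) • (A *ᵥ ζ)) ⬝ᵥ (A *ᵥ (ζ - (t : ℂ) • (A *ᵥ ζ)))).re
      = (star ζ ⬝ᵥ (A *ᵥ ζ)).re - 2 * t * (star (A *ᵥ ζ) ⬝ᵥ (A *ᵥ ζ)).re
        + t ^ 2 * (star (A *ᵥ ζ) ⬝ᵥ (A *ᵥ (A *ᵥ ζ))).re := by
  have h1 : star ζ ⬝ᵥ (A *ᵥ (A *ᵥ ζ)) = star (A *ᵥ ζ) ⬝ᵥ (A *ᵥ ζ) := by
    rw [star_mulVec_dotProduct, h.herm.eq]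
  simp only [mulVec_sub, mulVec_smul, star_sub, star_smul, sub_dotProduct, dotProduct_sub,
    smul_dotProduct, dotProduct_smul, smul_eq_mul, h1, RCLike.star_def, Complex.conj_ofReal,
    Complex.sub_re, Complex.re_ofReal_mul]
  ring

theorem FormBounded.re_mulVec_le (hm : 0 < m) (hM : 0 < M) (h : FormBounded m M A)
    (ζ : Fin d → ℂ) : (star (A *ᵥ ζ) ⬝ᵥ (A *ᵥ ζ)).re ≤ M ^ 2 * (star ζ ⬝ᵥ ζ).re := by
  have h0 : 0 ≤ (star (ζ - ((M⁻¹ : ℝ) : ℂ) • (A *ᵥ ζ)) ⬝ᵥ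
      (A *ᵥ (ζ - ((M⁻¹ : ℝ) : ℂ) • (A *ᵥ ζ)))).re :=
    le_trans (mul_nonneg hm.le (le_trans (sq_nonneg _) (sq_norm_le_re_star_dotProduct _)))
      (h.bound _).1
  rw [h.re_form_sub_smul] at h0
  have h1 := (h.bound ζ).2
  have h2 := (h.bound (A *ᵥ ζ)).2
  have h3 : M⁻¹ ^ 2 * (star (A *ᵥ ζ) ⬝ᵥ (A *ᵥ (A *ᵥ ζ))).re
      ≤ M⁻¹ * (star (A *ᵥ ζ) ⬝ᵥ (A *ᵥ ζ)).re := by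
    calc _ ≤ M⁻¹ ^ 2 * (M * (star (A *ᵥ ζ) ⬝ᵥ (A *ᵥ ζ)).re) := by gcongr
      _ = _ := by field_simp
  have h4 : M⁻¹ * (star (A *ᵥ ζ) ⬝ᵥ (A *ᵥ ζ)).re ≤ M * (star ζ ⬝ᵥ ζ).re := by linarith
  rw [inv_mul_le_iff₀ hM] at h4
  linarith

theorem FormBounded.le_re_mulVec (hm : 0 < m) (h : FormBounded m M A)
    (ζ : Fin d → ℂ) : m ^ 2 * (star ζ ⬝ᵥ ζ).re ≤ (star (A *ᵥ ζ) ⬝ᵥ (A *ᵥ ζ)).re := by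
  have h0 : 0 ≤ (star ((A *ᵥ ζ) - (m : ℂ) • ζ) ⬝ᵥ ((A *ᵥ ζ) - (m : ℂ) • ζ)).re :=
    le_trans (sq_nonneg _) (sq_norm_le_re_star_dotProduct _)
  simp only [star_sub, star_smul, sub_dotProduct, dotProduct_sub,
    smul_dotProduct, dotProduct_smul, smul_eq_mul, RCLike.star_def, Complex.conj_ofReal,
    Complex.sub_re, Complex.re_ofReal_mul, re_star_dotProduct_comm (A *ᵥ ζ) ζ] at h0
  nlinarith [(h.bound ζ).1]

theorem FormBounded.norm_mulVec_le (hm : 0 < m) (hM : 0 < M) (h : FormBounded m M A)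
    (ζ : Fin d → ℂ) : ‖A *ᵥ ζ‖ ≤ M * √d * ‖ζ‖ := by
  refine le_of_sq_le_sq ?_ (by positivity)
  calc ‖A *ᵥ ζ‖ ^ 2 ≤ M ^ 2 * (star ζ ⬝ᵥ ζ).re :=
        (sq_norm_le_re_star_dotProduct _).trans (h.re_mulVec_le hm hM ζ)
    _ ≤ M ^ 2 * (d * ‖ζ‖ ^ 2) := by gcongr; exact re_star_dotProduct_le ζ
    _ = (M * √d * ‖ζ‖) ^ 2 := by rw [mul_pow, mul_pow, Real.sq_sqrt (Nat.cast_nonneg d)]; ring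

theorem FormBounded.norm_le_mulVec (hm : 0 < m) (h : FormBounded m M A)
    (ζ : Fin d → ℂ) : ‖ζ‖ ≤ m⁻¹ * √d * ‖A *ᵥ ζ‖ := by
  refine le_of_sq_le_sq ?_ (by positivity)
  have h1 : m ^ 2 * ‖ζ‖ ^ 2 ≤ d * ‖A *ᵥ ζ‖ ^ 2 :=
    (mul_le_mul_of_nonneg_left (sq_norm_le_re_star_dotProduct ζ) (sq_nonneg m)).trans
      ((h.le_re_mulVec hm ζ).trans (re_star_dotProduct_le _))
  rw [mul_pow, mul_pow, Real.sq_sqrt (Nat.cast_nonneg d), inv_pow, mul_assoc,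
    le_inv_mul_iff₀ (by positivity)]
  exact h1

theorem FormBounded.isUnit_det (hm : 0 < m) (h : FormBounded m M A) : IsUnit A.det := by
  rw [← Matrix.isUnit_iff_isUnit_det, ← Matrix.mulVec_injective_iff_isUnit]
  refine (injective_iff_map_eq_zero (Matrix.mulVecLin A)).2 fun ζ hζ => ?_
  have h1 := h.norm_le_mulVec hm ζ
  rw [Matrix.mulVecLin_apply] at hζ
  simpa [hζ] using h1

theorem FormBounded.mulVec_inv (hm : 0 < m) (h : FormBounded m M A) (ζ : Fin d → ℂ) :
    A *ᵥ (A⁻¹ *ᵥ ζ) = ζ := by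
  rw [mulVec_mulVec, Matrix.mul_nonsing_inv _ (h.isUnit_det hm), one_mulVec]

theorem FormBounded.norm_inv_mulVec_le (hm : 0 < m) (h : FormBounded m M A)
    (ζ : Fin d → ℂ) : ‖A⁻¹ *ᵥ ζ‖ ≤ m⁻¹ * √d * ‖ζ‖ := by
  simpa [h.mulVec_inv hm] using h.norm_le_mulVec hm (A⁻¹ *ᵥ ζ)

end Pointwise

section SquareIntegrable

variable {X : Type*} [MeasurableSpace X] {μ : Measure X} {d : ℕ}

theorem MeasureTheory.MemLp.const_mulVec (P : Matrix (Fin d) (Fin d) ℂ) {f : X → Fin d → ℂ}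
    (hf : MemLp f 2 μ) : MemLp (fun x => P *ᵥ f x) 2 μ :=
  (LinearMap.toContinuousLinearMap (Matrix.mulVecLin P)).comp_memLp' hf

theorem integrable_star_dotProduct {f g : X → Fin d → ℂ} (hf : MemLp f 2 μ) (hg : MemLp g 2 μ) :
    Integrable (fun x => star (f x) ⬝ᵥ g x) μ := by
  simp only [dotProduct]
  refine integrable_finsetSum _ fun i _ => ?_
  exact (memLp_pi_iff.1 hf i).star.integrable_mul (memLp_pi_iff.1 hg i)

variable {m M : ℝ} {𝓗 : X → Matrix (Fin d) (Fin d) ℂ}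

theorem aestronglyMeasurable_matrix (hmeas : ∀ i j, AEMeasurable (fun x => 𝓗 x i j) μ) :
    AEStronglyMeasurable 𝓗 μ := by
  have h1 : ∀ i, AEMeasurable (fun x => 𝓗 x i) μ := fun i => aemeasurable_pi_iff.2 (hmeas i)
  have h2 : AEMeasurable (β := Fin d → Fin d → ℂ) (fun x => 𝓗 x) μ := aemeasurable_pi_iff.2 h1
  exact h2.aestronglyMeasurable

theorem aestronglyMeasurable_matrix_inv (h : AEStronglyMeasurable 𝓗 μ) :
    AEStronglyMeasurable (fun x => (𝓗 x)⁻¹) μ := by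
  have h1 : AEStronglyMeasurable (fun x => (𝓗 x).adjugate) μ :=
    (Continuous.matrix_adjugate continuous_id).comp_aestronglyMeasurable h
  have h2 : AEStronglyMeasurable (fun x => (𝓗 x).det) μ :=
    (Continuous.matrix_det continuous_id).comp_aestronglyMeasurable h
  have h3 : AEStronglyMeasurable (fun x => ((𝓗 x).det)⁻¹) μ :=
    h2.aemeasurable.inv.aestronglyMeasurable
  simp only [Matrix.inv_def, Ring.inverse_eq_inv']
  exact h3.smul h1

theorem aestronglyMeasurable_mulVec {f : X → Fin d → ℂ} (h : AEStronglyMeasurable 𝓗 μ)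
    (hf : AEStronglyMeasurable f μ) : AEStronglyMeasurable (fun x => 𝓗 x *ᵥ f x) μ :=
  (Continuous.matrix_mulVec continuous_fst continuous_snd).comp_aestronglyMeasurable
    (h.prodMk hf)

theorem memLp_mulVec (hm : 0 < m) (hM : 0 < M) (h : AEStronglyMeasurable 𝓗 μ)
    (hH : ∀ᵐ x ∂μ, FormBounded m M (𝓗 x)) {f : X → Fin d → ℂ} (hf : MemLp f 2 μ) :
    MemLp (fun x => 𝓗 x *ᵥ f x) 2 μ :=
  hf.of_le_mul (aestronglyMeasurable_mulVec h hf.1) <| by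
    filter_upwards [hH] with x hx using hx.norm_mulVec_le hm hM _

theorem memLp_inv_mulVec (hm : 0 < m) (h : AEStronglyMeasurable 𝓗 μ)
    (hH : ∀ᵐ x ∂μ, FormBounded m M (𝓗 x)) {f : X → Fin d → ℂ} (hf : MemLp f 2 μ) :
    MemLp (fun x => (𝓗 x)⁻¹ *ᵥ f x) 2 μ :=
  hf.of_le_mul (aestronglyMeasurable_mulVec (aestronglyMeasurable_matrix_inv h) hf.1) <| by
    filter_upwards [hH] with x hx using hx.norm_inv_mulVec_le hm _

/-- The Cauchy-Schwarz inequality for the norm of a function on a finite measure space. -/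
theorem sq_integral_norm_le [IsFiniteMeasure μ] {E : Type*} [NormedAddCommGroup E]
    {f : X → E} (hf : MemLp f 2 μ) :
    (∫ x, ‖f x‖ ∂μ) ^ 2 ≤ μ.real Set.univ * ∫ x, ‖f x‖ ^ 2 ∂μ := by
  rcases eq_or_ne μ 0 with rfl | h0
  · simp
  have hpos : 0 < μ.real Set.univ := by
    have := NeZero.mk h0
    exact measureReal_univ_pos
  set V := μ.real Set.univ
  set J := ∫ x, ‖f x‖ ∂μ
  have i1 : Integrable (fun x => ‖f x‖) μ := (hf.integrable (by norm_num)).norm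
  have i2 : Integrable (fun x => ‖f x‖ ^ 2) μ := (memLp_two_iff_integrable_sq_norm hf.1).1 hf
  have h : 0 ≤ ∫ x, (‖f x‖ ^ 2 - 2 * (J / V) * ‖f x‖ + (J / V) ^ 2) ∂μ :=
    integral_nonneg fun x => by
      have := sq_nonneg (‖f x‖ - J / V)
      simp only [Pi.zero_apply]
      linarith
  rw [integral_add (by fun_prop) (integrable_const _), integral_sub i2 (i1.const_mul _),
    integral_const_mul, integral_const, smul_eq_mul] at h
  change 0 ≤ _ - 2 * (J / V) * J + V * (J / V) ^ 2 at h
  have e : V * ((∫ x, ‖f x‖ ^ 2 ∂μ) - 2 * (J / V) * J + V * (J / V) ^ 2)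
      = V * (∫ x, ‖f x‖ ^ 2 ∂μ) - J ^ 2 := by field_simp; ring
  nlinarith [mul_nonneg hpos.le h]

end SquareIntegrable

section Weighted

variable {d : ℕ} {m M : ℝ} {𝓗 : ℝ → Matrix (Fin d) (Fin d) ℂ} {I : Set ℝ}

theorem memL2w_iff (hm : 0 < m) (hM : 0 < M)
    (h : AEStronglyMeasurable 𝓗 (volume.restrict I))
    (hH : ∀ᵐ ξ ∂(volume.restrict I), FormBounded m M (𝓗 ξ)) {x : ℝ → Fin d → ℂ} :
    MemL2w d 𝓗 I x ↔ MemLp x 2 (volume.restrict I) := by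
  constructor
  · rintro ⟨h1, h2⟩
    refine (memLp_two_iff_integrable_sq_norm h1).2 ?_
    refine (h2.const_mul m⁻¹).mono' (h1.norm.pow 2) ?_
    filter_upwards [hH] with ξ hξ
    rw [Real.norm_of_nonneg (by positivity), le_inv_mul_iff₀ hm]
    exact (mul_le_mul_of_nonneg_left (sq_norm_le_re_star_dotProduct _) hm.le).trans
      (hξ.bound _).1
  · intro hx
    exact ⟨hx.1, (integrable_star_dotProduct hx (memLp_mulVec hm hM h hH hx)).re⟩

theorem mul_integral_sq_norm_le_re_wip (hm : 0 < m) (hM : 0 < M)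
    (h : AEStronglyMeasurable 𝓗 (volume.restrict I))
    (hH : ∀ᵐ ξ ∂(volume.restrict I), FormBounded m M (𝓗 ξ)) {x : ℝ → Fin d → ℂ}
    (hx : MemLp x 2 (volume.restrict I)) :
    m * ∫ ξ in I, ‖x ξ‖ ^ 2 ≤ (wip d 𝓗 I x x).re := by
  have hi := integrable_star_dotProduct hx (memLp_mulVec hm hM h hH hx)
  rw [wip, ← RCLike.re_eq_complex_re, ← integral_re hi, ← integral_const_mul]
  refine integral_mono_ae (((memLp_two_iff_integrable_sq_norm hx.1).1 hx).const_mul m) hi.re ?_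
  filter_upwards [hH] with ξ hξ
  exact (mul_le_mul_of_nonneg_left (sq_norm_le_re_star_dotProduct _) hm.le).trans
      (hξ.bound _).1

theorem re_wip_le_mul_integral_sq_norm (hm : 0 < m) (hM : 0 < M)
    (h : AEStronglyMeasurable 𝓗 (volume.restrict I))
    (hH : ∀ᵐ ξ ∂(volume.restrict I), FormBounded m M (𝓗 ξ)) {x : ℝ → Fin d → ℂ}
    (hx : MemLp x 2 (volume.restrict I)) :
    (wip d 𝓗 I x x).re ≤ m⁻¹ * d * ∫ ξ in I, ‖𝓗 ξ *ᵥ x ξ‖ ^ 2 := by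
  have hHx := memLp_mulVec hm hM h hH hx
  have hi := integrable_star_dotProduct hx hHx
  rw [wip, ← RCLike.re_eq_complex_re, ← integral_re hi, ← integral_const_mul]
  refine integral_mono_ae hi.re (((memLp_two_iff_integrable_sq_norm hHx.1).1 hHx).const_mul _) ?_
  filter_upwards [hH] with ξ hξ
  have h0 : 0 ≤ (star ((𝓗 ξ *ᵥ x ξ) - (m : ℂ) • x ξ) ⬝ᵥ ((𝓗 ξ *ᵥ x ξ) - (m : ℂ) • x ξ)).re :=
    le_trans (sq_nonneg _) (sq_norm_le_re_star_dotProduct _)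
  simp only [star_sub, star_smul, sub_dotProduct, dotProduct_sub,
    smul_dotProduct, dotProduct_smul, smul_eq_mul, RCLike.star_def, Complex.conj_ofReal,
    Complex.sub_re, Complex.re_ofReal_mul, re_star_dotProduct_comm (𝓗 ξ *ᵥ x ξ) (x ξ)] at h0
  have h2 := re_star_dotProduct_le (𝓗 ξ *ᵥ x ξ)
  have h3 := (hξ.bound (x ξ)).1
  change (star (x ξ) ⬝ᵥ (𝓗 ξ *ᵥ x ξ)).re ≤ _
  rw [mul_assoc, le_inv_mul_iff₀ hm]
  nlinarith

end Weighted

section Primitive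

variable {b : ℝ}

theorem intervalIntegrable_of_mem_Icc {E : Type*} [NormedAddCommGroup E] {g : ℝ → E} {ξ : ℝ}
    (hg : IntegrableOn g (Set.Ioo 0 b)) (hξ : ξ ∈ Set.Icc 0 b) :
    IntervalIntegrable g volume 0 ξ :=
  (intervalIntegrable_iff_integrableOn_Ioo_of_le hξ.1).2
    (hg.mono_set (Set.Ioo_subset_Ioo_right hξ.2))

theorem intervalIntegral_eq_integral_Ioo {E : Type*} [NormedAddCommGroup E] [NormedSpace ℝ E]
    (hb : 0 ≤ b) (g : ℝ → E) : ∫ τ in (0 : ℝ)..b, g τ = ∫ τ in Set.Ioo 0 b, g τ := by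
  rw [intervalIntegral.integral_of_le hb, integral_Ioc_eq_integral_Ioo]

theorem norm_primitive_le {E : Type*} [NormedAddCommGroup E] [NormedSpace ℝ E] {g : ℝ → E}
    {ξ : ℝ} (hg : IntegrableOn g (Set.Ioo 0 b)) (hξ : ξ ∈ Set.Icc 0 b) :
    ‖∫ τ in (0 : ℝ)..ξ, g τ‖ ≤ ∫ τ in Set.Ioo 0 b, ‖g τ‖ := by
  rw [intervalIntegral_eq_integral_Ioo hξ.1]
  exact (norm_integral_le_integral_norm _).trans
    (setIntegral_mono_set hg.norm (Filter.Eventually.of_forall fun _ => norm_nonneg _)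
      (Set.Ioo_subset_Ioo_right hξ.2).eventuallyLE)

theorem memLp_primitive {E : Type*} [NormedAddCommGroup E] [NormedSpace ℝ E]
    [SecondCountableTopologyEither ℝ E] {g : ℝ → E} (hb : 0 ≤ b)
    (hg : IntegrableOn g (Set.Ioo 0 b)) :
    MemLp (fun ξ => ∫ τ in (0 : ℝ)..ξ, g τ) 2 (volume.restrict (Set.Ioo 0 b)) := by
  refine MemLp.of_bound ?_ (∫ τ in Set.Ioo 0 b, ‖g τ‖) ?_
  · have h := intervalIntegral.continuousOn_primitive_interval'
      (intervalIntegrable_of_mem_Icc hg ⟨hb, le_rfl⟩) Set.left_mem_uIcc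
    rw [Set.uIcc_of_le hb] at h
    exact (h.mono Set.Ioo_subset_Icc_self).aestronglyMeasurable measurableSet_Ioo
  · filter_upwards [ae_restrict_mem measurableSet_Ioo] with ξ hξ
    exact norm_primitive_le hg (Set.Ioo_subset_Icc_self hξ)

variable {d : ℕ}

theorem memLp_of_eq_primitive (hb : 0 ≤ b) {u g : ℝ → Fin d → ℂ}
    (hg : IntegrableOn g (Set.Ioo 0 b))
    (hu : ∀ ξ ∈ Set.Icc 0 b, u ξ = u 0 + ∫ τ in (0 : ℝ)..ξ, g τ) :
    MemLp u 2 (volume.restrict (Set.Ioo 0 b)) := by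
  refine ((memLp_const (u 0)).add (memLp_primitive hb hg)).ae_eq ?_
  filter_upwards [ae_restrict_mem measurableSet_Ioo] with ξ hξ
  exact (hu ξ (Set.Ioo_subset_Icc_self hξ)).symm

theorem primitive_apply {u g : ℝ → Fin d → ℂ} (hg : IntegrableOn g (Set.Ioo 0 b))
    (hu : ∀ ξ ∈ Set.Icc 0 b, u ξ = u 0 + ∫ τ in (0 : ℝ)..ξ, g τ) (i : Fin d) :
    ∀ ξ ∈ Set.Icc 0 b, u ξ i = u 0 i + ∫ τ in (0 : ℝ)..ξ, g τ i := by
  intro ξ hξ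
  have h := congrFun (hu ξ hξ) i
  rw [Pi.add_apply, intervalIntegral_eq_integral_Ioo hξ.1, eval_integral] at h
  · rw [h, intervalIntegral_eq_integral_Ioo hξ.1]
  · intro j
    exact (hg.mono_set (Set.Ioo_subset_Ioo_right hξ.2)).eval j

theorem primitive_mulVec (P : Matrix (Fin d) (Fin d) ℂ) {u g : ℝ → Fin d → ℂ}
    (hg : IntegrableOn g (Set.Ioo 0 b))
    (hu : ∀ ξ ∈ Set.Icc 0 b, u ξ = u 0 + ∫ τ in (0 : ℝ)..ξ, g τ) :
    ∀ ξ ∈ Set.Icc 0 b, P *ᵥ u ξ = P *ᵥ u 0 + ∫ τ in (0 : ℝ)..ξ, P *ᵥ g τ := by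
  intro ξ hξ
  rw [hu ξ hξ, mulVec_add]
  congr 1
  exact ((LinearMap.toContinuousLinearMap
    ((Matrix.mulVecLin P).restrictScalars ℝ)).intervalIntegral_comp_comm
      (intervalIntegrable_of_mem_Icc hg hξ)).symm

/-- Integration by parts for vector-valued primitives, the first of which vanishes at both
endpoints. -/
theorem integral_star_dotProduct_add_eq_zero (hb : 0 < b) {u g v h : ℝ → Fin d → ℂ}
    (hg : MemLp g 2 (volume.restrict (Set.Ioo 0 b)))
    (hh : MemLp h 2 (volume.restrict (Set.Ioo 0 b)))
    (hu : ∀ ξ ∈ Set.Icc 0 b, u ξ = u 0 + ∫ τ in (0 : ℝ)..ξ, g τ)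
    (hv : ∀ ξ ∈ Set.Icc 0 b, v ξ = v 0 + ∫ τ in (0 : ℝ)..ξ, h τ)
    (hu0 : u 0 = 0) (hub : u b = 0) :
    ∫ ξ in Set.Ioo 0 b, (star (g ξ) ⬝ᵥ v ξ + star (u ξ) ⬝ᵥ h ξ) = 0 := by
  have ig : IntegrableOn g (Set.Ioo 0 b) := hg.integrable (by norm_num)
  have ih : IntegrableOn h (Set.Ioo 0 b) := hh.integrable (by norm_num)
  have key (i : Fin d) : ∫ ξ in Set.Ioo 0 b, (star (g ξ i) * v ξ i + star (u ξ i) * h ξ i) = 0 := by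
    have hu' := primitive_apply ig hu i
    rw [integral_add_mul_of_eq_integral (p := fun ξ => star (u ξ i)) (p' := fun ξ => star (g ξ i))
      (q := fun ξ => v ξ i) (q' := fun ξ => h ξ i) hb _ (ih.eval i) _ (primitive_apply ih hv i)]
    · simp [hu0, hub]
    · exact (memLp_pi_iff.1 hg i).star.integrable (by norm_num)
    · intro ξ hξ
      rw [hu' ξ hξ, star_add, intervalIntegral_eq_integral_Ioo hξ.1,
        intervalIntegral_eq_integral_Ioo hξ.1]
      congr 1
      exact integral_conj.symm
  have vL := memLp_of_eq_primitive hb.le ih hv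
  have uL := memLp_of_eq_primitive hb.le ig hu
  simp only [dotProduct, ← Finset.sum_add_distrib, Pi.star_apply]
  rw [integral_finsetSum]
  · exact Finset.sum_eq_zero fun i _ => key i
  · intro i _
    exact ((memLp_pi_iff.1 hg i).star.integrable_mul (memLp_pi_iff.1 vL i)).add
      ((memLp_pi_iff.1 uL i).star.integrable_mul (memLp_pi_iff.1 hh i))

/-- A square integrable function which is orthogonal to every mean-zero square integrable
function is constant almost everywhere. -/
theorem exists_ae_eq_const_of_forall_mean_zero (hb : 0 < b) {q : ℝ → Fin d → ℂ}
    (hq : MemLp q 2 (volume.restrict (Set.Ioo 0 b)))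
    (h : ∀ g : ℝ → Fin d → ℂ, MemLp g 2 (volume.restrict (Set.Ioo 0 b)) →
      ∫ τ in (0 : ℝ)..b, g τ = 0 → ∫ ξ in Set.Ioo 0 b, star (g ξ) ⬝ᵥ q ξ = 0) :
    ∃ c, ∀ᵐ ξ ∂(volume.restrict (Set.Ioo 0 b)), q ξ = c := by
  have iq := hq.integrable (by norm_num)
  set c : Fin d → ℂ := b⁻¹ • ∫ ξ in Set.Ioo 0 b, q ξ with hc
  set g : ℝ → Fin d → ℂ := fun ξ => q ξ - c with hg
  have gL : MemLp g 2 (volume.restrict (Set.Ioo 0 b)) := hq.sub (memLp_const c)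
  have ig := gL.integrable (by norm_num)
  have g0 : ∫ ξ in Set.Ioo 0 b, g ξ = 0 := by
    rw [hg, integral_sub iq (integrable_const _), integral_const]
    simp [hc, smul_smul, hb.le, hb.ne']
  have h1 := h g gL (by rw [intervalIntegral_eq_integral_Ioo hb.le, g0])
  have h2 : ∫ ξ in Set.Ioo 0 b, star (g ξ) ⬝ᵥ c = 0 := by
    simp only [dotProduct, Pi.star_apply]
    rw [integral_finsetSum]
    · refine Finset.sum_eq_zero fun i _ => ?_
      rw [integral_mul_const]
      have : ∫ ξ in Set.Ioo 0 b, star (g ξ i) = 0 := by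
        refine integral_conj.trans ?_
        rw [← eval_integral (fun j => ig.eval j), g0]
        simp
      rw [this, zero_mul]
    · intro i _
      exact ((memLp_pi_iff.1 gL i).star.integrable (by norm_num)).mul_const _
  have h3 : ∫ ξ in Set.Ioo 0 b, star (g ξ) ⬝ᵥ g ξ = 0 := by
    have e : ∀ ξ, star (g ξ) ⬝ᵥ g ξ = star (g ξ) ⬝ᵥ q ξ - star (g ξ) ⬝ᵥ c := fun ξ => by
      rw [← dotProduct_sub]
    simp only [e]
    rw [integral_sub (integrable_star_dotProduct gL hq)
      (integrable_star_dotProduct gL (memLp_const c)), h1, h2, sub_zero]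
  have i3 := integrable_star_dotProduct gL gL
  have h4 : ∫ ξ in Set.Ioo 0 b, (star (g ξ) ⬝ᵥ g ξ).re = 0 := by
    have := integral_re i3
    rw [h3] at this
    exact this
  have h5 := (integral_eq_zero_iff_of_nonneg
    (fun ξ => le_trans (sq_nonneg _) (sq_norm_le_re_star_dotProduct (g ξ))) i3.re).1 h4
  refine ⟨c, ?_⟩
  filter_upwards [h5] with ξ hξ
  have h6 : ‖g ξ‖ ^ 2 ≤ 0 := (sq_norm_le_re_star_dotProduct (g ξ)).trans hξ.le
  have h7 : g ξ = 0 := by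
    rw [← norm_eq_zero]
    exact pow_eq_zero_iff (two_ne_zero) |>.1 (le_antisymm h6 (sq_nonneg _))
  exact sub_eq_zero.1 h7

end Primitive

section Density

variable {b : ℝ} {d : ℕ}

theorem tendsto_integral_sq_norm_pow_smul (hb : 0 < b) {φ : ℝ → Fin d → ℂ}
    (hφ : Continuous φ) :
    Filter.Tendsto (fun n : ℕ => ∫ ξ in Set.Ioo 0 b, ‖((1 - 2 * ξ / b) ^ (2 * n)) • φ ξ‖ ^ 2)
      Filter.atTop (nhds 0) := by
  have hφi : IntegrableOn (fun ξ => ‖φ ξ‖ ^ 2) (Set.Ioo 0 b) :=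
    ((hφ.norm.pow 2).integrableOn_Icc).mono_set Set.Ioo_subset_Icc_self
  have habs : ∀ ξ ∈ Set.Ioo 0 b, |1 - 2 * ξ / b| < 1 := by
    rintro ξ ⟨h0, h1⟩
    have h2 : 0 < ξ / b := by positivity
    have h3 : ξ / b < 1 := (div_lt_one hb).2 h1
    rw [abs_lt, mul_div_assoc]
    constructor <;> linarith
  have h := tendsto_integral_of_dominated_convergence (μ := volume.restrict (Set.Ioo 0 b))
    (F := fun (n : ℕ) ξ => ‖((1 - 2 * ξ / b) ^ (2 * n)) • φ ξ‖ ^ 2) (f := fun _ => 0)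
    (fun ξ => ‖φ ξ‖ ^ 2) (fun n => by
      refine Continuous.aestronglyMeasurable ?_
      fun_prop) hφi (fun n => ?_) ?_
  · simpa using h
  · filter_upwards [ae_restrict_mem measurableSet_Ioo] with ξ hξ
    rw [Real.norm_of_nonneg (by positivity), norm_smul, norm_pow, Real.norm_eq_abs]
    gcongr
    exact mul_le_of_le_one_left (norm_nonneg _)
      (pow_le_one₀ (abs_nonneg _) (habs ξ hξ).le)
  · filter_upwards [ae_restrict_mem measurableSet_Ioo] with ξ hξ
    have h1 : Filter.Tendsto (fun n : ℕ => (1 - 2 * ξ / b) ^ (2 * n)) Filter.atTop (nhds 0) :=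
      (tendsto_pow_atTop_nhds_zero_of_abs_lt_one (habs ξ hξ)).comp
        (Filter.tendsto_atTop_mono (fun n => by simp only [id]; omega) Filter.tendsto_id)
    simpa using ((h1.smul_const (φ ξ)).norm.pow 2)

/-- Primitives of square integrable functions which vanish at both endpoints are dense in `L²`. -/
theorem exists_primitive_integral_sq_norm_sub_lt (hb : 0 < b) {v : ℝ → Fin d → ℂ}
    (hv : MemLp v 2 (volume.restrict (Set.Ioo 0 b))) {ε : ℝ} (hε : 0 < ε) :
    ∃ u g : ℝ → Fin d → ℂ, MemLp g 2 (volume.restrict (Set.Ioo 0 b)) ∧ u 0 = 0 ∧ u b = 0 ∧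
      (∀ ξ ∈ Set.Icc 0 b, u ξ = u 0 + ∫ τ in (0 : ℝ)..ξ, g τ) ∧
      ∫ ξ in Set.Ioo 0 b, ‖u ξ - v ξ‖ ^ 2 < ε := by
  obtain ⟨φ, -, hφ, hφv⟩ := hv.exist_eLpNorm_sub_le (by norm_num) (by norm_num)
    (ε := √(ε / 8)) (by positivity)
  have hcont {f : ℝ → Fin d → ℂ} (hf : Continuous f) :
      MemLp f 2 (volume.restrict (Set.Ioo 0 b)) :=
    (memLp_two_iff_integrable_sq_norm hf.aestronglyMeasurable).2
      (((hf.norm.pow 2).integrableOn_Icc).mono_set Set.Ioo_subset_Icc_self)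
  have hφL := hcont hφ.continuous
  have h1 : ∫ ξ in Set.Ioo 0 b, ‖φ ξ - v ξ‖ ^ 2 ≤ ε / 8 := by
    rw [(hv.sub hφL).eLpNorm_eq_integral_rpow_norm (by norm_num) (by norm_num),
      ENNReal.ofReal_le_ofReal_iff (Real.sqrt_nonneg _), ENNReal.toReal_ofNat,
      ← one_div, ← Real.sqrt_eq_rpow, Real.sqrt_le_sqrt_iff (by positivity)] at hφv
    simpa [norm_sub_rev] using hφv
  obtain ⟨n, hn⟩ := ((tendsto_order.1 (tendsto_integral_sq_norm_pow_smul hb hφ.continuous)).2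
    (ε / 8) (by positivity)).and (Filter.eventually_gt_atTop 0) |>.exists
  set r : ℝ → ℝ := fun ξ => (1 - 2 * ξ / b) ^ (2 * n) with hr
  have hrs : ContDiff ℝ 1 r := by fun_prop
  have hu : ContDiff ℝ 1 (fun ξ => φ ξ - r ξ • φ ξ) :=
    (hφ.of_le (by simp)).sub (hrs.smul (hφ.of_le (by simp)))
  have hu0 : φ 0 - r 0 • φ 0 = 0 := by simp [hr]
  refine ⟨fun ξ => φ ξ - r ξ • φ ξ, deriv (fun ξ => φ ξ - r ξ • φ ξ),
    hcont (hu.continuous_deriv le_rfl), hu0, ?_, ?_, ?_⟩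
  · simp only [hr, mul_div_assoc, div_self hb.ne']
    norm_num
  · intro ξ _
    rw [intervalIntegral.integral_deriv_eq_sub
      (fun x _ => (hu.differentiable (by norm_num)).differentiableAt)
      ((hu.continuous_deriv le_rfl).intervalIntegrable _ _)]
    simp
  · have hrL : MemLp (fun ξ => r ξ • φ ξ) 2 (volume.restrict (Set.Ioo 0 b)) :=
      hcont (hrs.continuous.smul hφ.continuous)
    have i1 := ((memLp_two_iff_integrable_sq_norm (hφL.sub hv).1).1 (hφL.sub hv)).const_mul 2
    have i2 := ((memLp_two_iff_integrable_sq_norm hrL.1).1 hrL).const_mul 2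
    calc ∫ ξ in Set.Ioo 0 b, ‖φ ξ - r ξ • φ ξ - v ξ‖ ^ 2
        ≤ ∫ ξ in Set.Ioo 0 b, (2 * ‖φ ξ - v ξ‖ ^ 2 + 2 * ‖r ξ • φ ξ‖ ^ 2) := by
          refine integral_mono_of_nonneg (Filter.Eventually.of_forall fun _ => by positivity)
            (i1.add i2) (Filter.Eventually.of_forall fun ξ => ?_)
          have h2 : ‖φ ξ - r ξ • φ ξ - v ξ‖ ≤ ‖φ ξ - v ξ‖ + ‖r ξ • φ ξ‖ := by
            rw [sub_right_comm]
            exact norm_sub_le _ _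
          have h3 := pow_le_pow_left₀ (norm_nonneg _) h2 2
          dsimp only
          nlinarith [sq_nonneg (‖φ ξ - v ξ‖ - ‖r ξ • φ ξ‖)]
      _ = 2 * (∫ ξ in Set.Ioo 0 b, ‖φ ξ - v ξ‖ ^ 2)
          + 2 * ∫ ξ in Set.Ioo 0 b, ‖r ξ • φ ξ‖ ^ 2 := by
          rw [← integral_const_mul, ← integral_const_mul]
          exact integral_add i1 i2
      _ < ε := by linarith [hn.1]

end Density
section Operator

variable {b m M : ℝ} {d : ℕ} {𝓗 : ℝ → Matrix (Fin d) (Fin d) ℂ} {P1 P0 : Matrix (Fin d) (Fin d) ℂ}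

theorem graphA10_inv_mulVec (hb : 0 ≤ b) (hm : 0 < m) (hM : 0 < M)
    (h : AEStronglyMeasurable 𝓗 (volume.restrict (Set.Ioo 0 b)))
    (hH : ∀ᵐ ξ ∂(volume.restrict (Set.Ioo 0 b)), FormBounded m M (𝓗 ξ))
    {u g : ℝ → Fin d → ℂ} (hg : MemLp g 2 (volume.restrict (Set.Ioo 0 b)))
    (hu : ∀ ξ ∈ Set.Icc 0 b, u ξ = u 0 + ∫ τ in (0 : ℝ)..ξ, g τ) (hu0 : u 0 = 0)
    (hub : u b = 0) :
    GraphA10 d 𝓗 P1 P0 b (fun ξ => (𝓗 ξ)⁻¹ *ᵥ u ξ) (fun ξ => P1 *ᵥ g ξ + P0 *ᵥ u ξ) := by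
  have uL := memLp_of_eq_primitive hb (hg.integrable (by norm_num)) hu
  refine ⟨(memL2w_iff hm hM h hH).2 (memLp_inv_mulVec hm h hH uL),
    (memL2w_iff hm hM h hH).2 ((hg.const_mulVec P1).add (uL.const_mulVec P0)),
    u, g, ⟨?_, hu, (memL2w_iff hm hM h hH).2 hg⟩, hu0, hub, .of_forall fun _ => rfl⟩
  filter_upwards [hH] with ξ hξ
  exact (hξ.mulVec_inv hm _).symm

/-- The Green-type identity: the defect of adjointness in terms of the representatives. -/
theorem wip_sub_wip_eq_integral (hm : 0 < m) (hM : 0 < M)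
    (h : AEStronglyMeasurable 𝓗 (volume.restrict (Set.Ioo 0 b)))
    (hH : ∀ᵐ ξ ∂(volume.restrict (Set.Ioo 0 b)), FormBounded m M (𝓗 ξ))
    (hP1 : P1.IsHermitian) (hP0 : P0.conjTranspose = -P0)
    {u g x w y z v : ℝ → Fin d → ℂ}
    (hx : MemL2w d 𝓗 (Set.Ioo 0 b) x) (hw : MemL2w d 𝓗 (Set.Ioo 0 b) w)
    (hy : MemL2w d 𝓗 (Set.Ioo 0 b) y) (hz : MemL2w d 𝓗 (Set.Ioo 0 b) z)
    (hu : RepOn d 𝓗 b x u g)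
    (hwu : ∀ᵐ ξ ∂(volume.restrict (Set.Ioo 0 b)), w ξ = P1 *ᵥ (g ξ) + P0 *ᵥ (u ξ))
    (hv : ∀ᵐ ξ ∂(volume.restrict (Set.Ioo 0 b)), v ξ = 𝓗 ξ *ᵥ y ξ) :
    wip d 𝓗 (Set.Ioo 0 b) w y - wip d 𝓗 (Set.Ioo 0 b) x z
      = ∫ ξ in Set.Ioo 0 b,
          (star (g ξ) ⬝ᵥ (P1 *ᵥ v ξ) + star (u ξ) ⬝ᵥ (-(P0 *ᵥ v ξ + z ξ))) := by
  rw [memL2w_iff hm hM h hH] at hx hw hy hz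
  rw [wip, wip, ← integral_sub (integrable_star_dotProduct hw (memLp_mulVec hm hM h hH hy))
    (integrable_star_dotProduct hx (memLp_mulVec hm hM h hH hz))]
  refine integral_congr_ae ?_
  filter_upwards [hH, hu.1, hwu, hv] with ξ h1 h2 h3 h4
  have h5 : star (x ξ) ⬝ᵥ (𝓗 ξ *ᵥ z ξ) = star (u ξ) ⬝ᵥ z ξ := by
    rw [h2, star_mulVec_dotProduct, h1.herm.eq]
  rw [h5, h3, ← h4, star_add, add_dotProduct, star_mulVec_dotProduct, star_mulVec_dotProduct,
    hP1.eq, hP0, neg_mulVec, dotProduct_neg, dotProduct_neg, dotProduct_add]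
  ring

/-- The adjoint of the minimal operator is the negative of the maximal one. -/
theorem exists_repOn_iff (hb : 0 < b) (hm : 0 < m) (hM : 0 < M)
    (h : AEStronglyMeasurable 𝓗 (volume.restrict (Set.Ioo 0 b)))
    (hH : ∀ᵐ ξ ∂(volume.restrict (Set.Ioo 0 b)), FormBounded m M (𝓗 ξ))
    (hP1 : P1.IsHermitian) (hP1inv : IsUnit P1) (hP0 : P0.conjTranspose = -P0)
    {y z : ℝ → Fin d → ℂ}
    (hy : MemL2w d 𝓗 (Set.Ioo 0 b) y) (hz : MemL2w d 𝓗 (Set.Ioo 0 b) z) :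
    (∀ x w, GraphA10 d 𝓗 P1 P0 b x w →
        wip d 𝓗 (Set.Ioo 0 b) w y = wip d 𝓗 (Set.Ioo 0 b) x z) ↔
      ∃ u g, RepOn d 𝓗 b y u g ∧
        (∀ᵐ ξ ∂(volume.restrict (Set.Ioo 0 b)), z ξ = -(P1 *ᵥ (g ξ)) - P0 *ᵥ (u ξ)) := by
  constructor
  · intro hyz
    have yL := (memL2w_iff hm hM h hH).1 hy
    have zL := (memL2w_iff hm hM h hH).1 hz
    have vL := memLp_mulVec hm hM h hH yL
    set v : ℝ → Fin d → ℂ := fun ξ => 𝓗 ξ *ᵥ y ξ with hv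
    set f : ℝ → Fin d → ℂ := fun ξ => P0 *ᵥ v ξ + z ξ with hf
    have fL : MemLp f 2 (volume.restrict (Set.Ioo 0 b)) := (vL.const_mulVec P0).add zL
    have fi := fL.integrable (by norm_num)
    set F : ℝ → Fin d → ℂ := fun ξ => ∫ τ in (0 : ℝ)..ξ, f τ with hF
    have FL : MemLp F 2 (volume.restrict (Set.Ioo 0 b)) := memLp_primitive hb.le fi
    obtain ⟨c, hc⟩ := exists_ae_eq_const_of_forall_mean_zero hb ((vL.const_mulVec P1).add FL)
      (fun g hg hg0 => by
        set u : ℝ → Fin d → ℂ := fun ξ => ∫ τ in (0 : ℝ)..ξ, g τ with hu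
        have hu0 : u 0 = 0 := by simp [hu]
        have hu' : ∀ ξ ∈ Set.Icc 0 b, u ξ = u 0 + ∫ τ in (0 : ℝ)..ξ, g τ := by simp [hu]
        have hgr := graphA10_inv_mulVec (P1 := P1) (P0 := P0) hb.le hm hM h hH hg hu' hu0 hg0
        have uL := memLp_of_eq_primitive hb.le (hg.integrable (by norm_num)) hu'
        have e1 := wip_sub_wip_eq_integral (v := v) hm hM h hH hP1 hP0 hgr.1 hgr.2.1 hy hz
          (u := u) (g := g) ⟨by
            filter_upwards [hH] with ξ hξ using (hξ.mulVec_inv hm _).symm, hu',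
            (memL2w_iff hm hM h hH).2 hg⟩ (.of_forall fun _ => rfl) (.of_forall fun _ => rfl)
        rw [hyz _ _ hgr, sub_self] at e1
        have e2 := integral_star_dotProduct_add_eq_zero hb hg fL hu' (v := F) (by simp [hF])
          hu0 hg0
        have i1 := (integrable_star_dotProduct hg (vL.const_mulVec P1)).add
          (integrable_star_dotProduct uL fL.neg)
        have i2 := (integrable_star_dotProduct hg FL).add (integrable_star_dotProduct uL fL)
        have e3 := (integral_add i1 i2).trans (congrArg₂ (· + ·) e1.symm e2)
        rw [add_zero] at e3
        rw [← e3]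
        refine integral_congr_ae (.of_forall fun ξ => ?_)
        simp only [Pi.add_apply, Pi.neg_apply, dotProduct_add, dotProduct_neg]
        ring)
    have hdet := (Matrix.isUnit_iff_isUnit_det P1).1 hP1inv
    have hc' : ∀ᵐ ξ ∂(volume.restrict (Set.Ioo 0 b)), P1⁻¹ *ᵥ (c - F ξ) = v ξ := by
      filter_upwards [hc] with ξ hξ
      rw [← hξ, Pi.add_apply, add_sub_cancel_right, mulVec_mulVec,
        Matrix.nonsing_inv_mul _ hdet, one_mulVec]
    refine ⟨fun ξ => P1⁻¹ *ᵥ (c - F ξ), fun ξ => P1⁻¹ *ᵥ (-f ξ), ⟨?_, ?_, ?_⟩, ?_⟩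
    · filter_upwards [hc'] with ξ hξ
      rw [hξ]
    · refine primitive_mulVec P1⁻¹ (u := fun ξ => c - F ξ) fi.neg fun ξ _ => ?_
      simp [hF, sub_eq_add_neg]
    · exact (memL2w_iff hm hM h hH).2 (fL.neg.const_mulVec P1⁻¹)
    · filter_upwards [hc'] with ξ hξ
      rw [hξ, mulVec_mulVec, Matrix.mul_nonsing_inv _ hdet, one_mulVec]
      simp [hf]
  · rintro ⟨v, k, hv, hzv⟩ x w ⟨hx, hw, u, g, hu, hu0, hub, hwu⟩
    have gL := (memL2w_iff hm hM h hH).1 hu.2.2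
    have kL := (memL2w_iff hm hM h hH).1 hv.2.2
    rw [← sub_eq_zero, wip_sub_wip_eq_integral hm hM h hH hP1 hP0 hx hw hy hz hu hwu hv.1,
      ← integral_star_dotProduct_add_eq_zero hb gL (kL.const_mulVec P1) hu.2.1
        (primitive_mulVec P1 (kL.integrable (by norm_num)) hv.2.1) hu0 hub]
    refine integral_congr_ae ?_
    filter_upwards [hzv] with ξ hξ
    rw [hξ]
    simp

end Operator
section Closed

variable {b m M : ℝ} {d : ℕ} {𝓗 : ℝ → Matrix (Fin d) (Fin d) ℂ} {P1 P0 : Matrix (Fin d) (Fin d) ℂ}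

theorem tendsto_integral_norm_of_tendsto_re_wip {I : Set ℝ} [IsFiniteMeasure (volume.restrict I)]
    (hm : 0 < m) (hM : 0 < M) (h : AEStronglyMeasurable 𝓗 (volume.restrict I))
    (hH : ∀ᵐ ξ ∂(volume.restrict I), FormBounded m M (𝓗 ξ)) {f : ℕ → ℝ → Fin d → ℂ}
    (hf : ∀ n, MemLp (f n) 2 (volume.restrict I))
    (hlim : Filter.Tendsto (fun n => (wip d 𝓗 I (f n) (f n)).re) Filter.atTop (nhds 0)) :
    Filter.Tendsto (fun n => ∫ ξ in I, ‖f n ξ‖) Filter.atTop (nhds 0) := by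
  set V := (volume.restrict I).real Set.univ
  have h1 : Filter.Tendsto (fun n => √(V * (m⁻¹ * (wip d 𝓗 I (f n) (f n)).re)))
      Filter.atTop (nhds 0) := by
    simpa using ((hlim.const_mul m⁻¹).const_mul V).sqrt
  refine squeeze_zero (fun n => integral_nonneg fun _ => norm_nonneg _) (fun n => ?_) h1
  refine Real.le_sqrt_of_sq_le ((sq_integral_norm_le (hf n)).trans ?_)
  refine mul_le_mul_of_nonneg_left ?_ measureReal_nonneg
  rw [le_inv_mul_iff₀ hm]
  exact mul_integral_sq_norm_le_re_wip hm hM h hH (hf n)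

theorem exists_norm_mulVec_le (P : Matrix (Fin d) (Fin d) ℂ) :
    ∃ C : ℝ, ∀ ζ, ‖P *ᵥ ζ‖ ≤ C * ‖ζ‖ :=
  ⟨_, (LinearMap.toContinuousLinearMap (Matrix.mulVecLin P)).le_opNorm⟩

/-- The graph of the minimal operator is sequentially closed. -/
theorem graphA10_of_tendsto (hb : 0 < b) (hm : 0 < m) (hM : 0 < M)
    (h : AEStronglyMeasurable 𝓗 (volume.restrict (Set.Ioo 0 b)))
    (hH : ∀ᵐ ξ ∂(volume.restrict (Set.Ioo 0 b)), FormBounded m M (𝓗 ξ))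
    (hP1inv : IsUnit P1) {xs ys : ℕ → ℝ → Fin d → ℂ} {x y : ℝ → Fin d → ℂ}
    (hgr : ∀ n, GraphA10 d 𝓗 P1 P0 b (xs n) (ys n))
    (hx : MemL2w d 𝓗 (Set.Ioo 0 b) x) (hy : MemL2w d 𝓗 (Set.Ioo 0 b) y)
    (hxs : Filter.Tendsto (fun n =>
      (wip d 𝓗 (Set.Ioo 0 b) (fun ξ => xs n ξ - x ξ) (fun ξ => xs n ξ - x ξ)).re)
      Filter.atTop (nhds 0))
    (hys : Filter.Tendsto (fun n =>
      (wip d 𝓗 (Set.Ioo 0 b) (fun ξ => ys n ξ - y ξ) (fun ξ => ys n ξ - y ξ)).re)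
      Filter.atTop (nhds 0)) :
    GraphA10 d 𝓗 P1 P0 b x y := by
  have hdet := (Matrix.isUnit_iff_isUnit_det P1).1 hP1inv
  have xL := (memL2w_iff hm hM h hH).1 hx
  have yL := (memL2w_iff hm hM h hH).1 hy
  have vL := memLp_mulVec hm hM h hH xL
  have xsL n := ((memL2w_iff hm hM h hH).1 (hgr n).1).sub xL
  have ysL n := ((memL2w_iff hm hM h hH).1 (hgr n).2.1).sub yL
  choose _ _ us gs hrep hu0 hub hyu using hgr
  have gsL n := (memL2w_iff hm hM h hH).1 (hrep n).2.2
  have usL n := memLp_of_eq_primitive hb.le ((gsL n).integrable (by norm_num)) (hrep n).2.1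
  set v : ℝ → Fin d → ℂ := fun ξ => 𝓗 ξ *ᵥ x ξ with hv
  set g : ℝ → Fin d → ℂ := fun ξ => P1⁻¹ *ᵥ (y ξ - P0 *ᵥ v ξ) with hg
  have gL : MemLp g 2 (volume.restrict (Set.Ioo 0 b)) :=
    (yL.sub (vL.const_mulVec P0)).const_mulVec P1⁻¹
  have gi : IntegrableOn g (Set.Ioo 0 b) := gL.integrable (by norm_num)
  have gsi n : IntegrableOn (gs n) (Set.Ioo 0 b) := (gsL n).integrable (by norm_num)
  have tx := tendsto_integral_norm_of_tendsto_re_wip hm hM h hH xsL hxs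
  have ty := tendsto_integral_norm_of_tendsto_re_wip hm hM h hH ysL hys
  have ix n := ((xsL n).integrable (by norm_num : 1 ≤ (2 : ENNReal))).norm
  have iy n := ((ysL n).integrable (by norm_num : 1 ≤ (2 : ENNReal))).norm
  have iu n := (((usL n).sub vL).integrable (by norm_num : 1 ≤ (2 : ENNReal))).norm
  have ig n := (((gsL n).sub gL).integrable (by norm_num : 1 ≤ (2 : ENNReal))).norm
  simp only [Pi.sub_apply] at tx ty ix iy iu ig
  have tu : Filter.Tendsto (fun n => ∫ ξ in Set.Ioo 0 b, ‖us n ξ - v ξ‖)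
      Filter.atTop (nhds 0) := by
    refine squeeze_zero (fun n => integral_nonneg fun _ => norm_nonneg _) (fun n => ?_)
      (by simpa using tx.const_mul (M * √d))
    rw [← integral_const_mul]
    refine integral_mono_ae (iu n) ((ix n).const_mul _) ?_
    filter_upwards [hH, (hrep n).1] with ξ h1 h2
    rw [h2, hv, ← mulVec_sub]
    exact h1.norm_mulVec_le hm hM _
  obtain ⟨C₁, hC₁⟩ := exists_norm_mulVec_le P1⁻¹
  obtain ⟨C₂, hC₂⟩ := exists_norm_mulVec_le (P1⁻¹ * P0)
  have tg : Filter.Tendsto (fun n => ∫ ξ in Set.Ioo 0 b, ‖gs n ξ - g ξ‖)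
      Filter.atTop (nhds 0) := by
    refine squeeze_zero (fun n => integral_nonneg fun _ => norm_nonneg _) (fun n => ?_)
      (by simpa using (ty.const_mul C₁).add (tu.const_mul C₂))
    rw [← integral_const_mul, ← integral_const_mul,
      ← integral_add ((iy n).const_mul _) ((iu n).const_mul _)]
    refine integral_mono_ae (ig n) (((iy n).const_mul _).add ((iu n).const_mul _)) ?_
    filter_upwards [hyu n] with ξ h1
    have e : gs n ξ - g ξ = P1⁻¹ *ᵥ (ys n ξ - y ξ) - (P1⁻¹ * P0) *ᵥ (us n ξ - v ξ) := by
      rw [h1, hg]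
      simp only [mulVec_sub, mulVec_add, mulVec_mulVec, Matrix.nonsing_inv_mul _ hdet, one_mulVec]
      abel
    rw [e]
    exact (norm_sub_le _ _).trans (add_le_add (hC₁ _) (hC₂ _))
  set U : ℝ → Fin d → ℂ := fun ξ => ∫ τ in (0 : ℝ)..ξ, g τ with hU
  have UL : MemLp U 2 (volume.restrict (Set.Ioo 0 b)) := memLp_primitive hb.le gi
  have hUu n : ∀ ξ ∈ Set.Icc 0 b, ‖us n ξ - U ξ‖ ≤ ∫ ξ in Set.Ioo 0 b, ‖gs n ξ - g ξ‖ := by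
    intro ξ hξ
    rw [(hrep n).2.1 ξ hξ, hu0, zero_add, hU,
      ← intervalIntegral.integral_sub (intervalIntegrable_of_mem_Icc (gsi n) hξ)
        (intervalIntegrable_of_mem_Icc gi hξ)]
    exact norm_primitive_le ((gsi n).sub gi) hξ
  have hUb : U b = 0 := by
    refine norm_le_zero_iff.1 (ge_of_tendsto' tg fun n => ?_)
    simpa [hub n] using hUu n b ⟨hb.le, le_rfl⟩
  have iUv := ((UL.sub vL).integrable (by norm_num : 1 ≤ (2 : ENNReal))).norm
  have hUv : ∫ ξ in Set.Ioo 0 b, ‖U ξ - v ξ‖ ≤ 0 := by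
    refine ge_of_tendsto' (by simpa using (tg.const_mul b).add tu) fun n => ?_
    have e : b * ∫ ξ in Set.Ioo 0 b, ‖gs n ξ - g ξ‖
        = ∫ _ξ in Set.Ioo 0 b, ∫ ξ in Set.Ioo 0 b, ‖gs n ξ - g ξ‖ := by
      simp [hb.le]
    rw [e, ← integral_add (integrable_const _) (iu n)]
    refine integral_mono_ae iUv ((integrable_const _).add (iu n)) ?_
    filter_upwards [ae_restrict_mem measurableSet_Ioo] with ξ hξ
    refine (norm_sub_le_norm_sub_add_norm_sub (U ξ) (us n ξ) (v ξ)).trans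
      (add_le_add_left ?_ _)
    rw [norm_sub_rev]
    exact hUu n ξ (Set.Ioo_subset_Icc_self hξ)
  have hUv' : ∀ᵐ ξ ∂(volume.restrict (Set.Ioo 0 b)), U ξ = v ξ := by
    have h1 := (integral_eq_zero_iff_of_nonneg (fun _ => norm_nonneg _) iUv).1
      (le_antisymm hUv (integral_nonneg fun _ => norm_nonneg _))
    filter_upwards [h1] with ξ hξ
    exact sub_eq_zero.1 (norm_eq_zero.1 hξ)
  refine ⟨hx, hy, U, g, ⟨hUv', by simp [hU], (memL2w_iff hm hM h hH).2 gL⟩, by simp [hU],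
    hUb, ?_⟩
  filter_upwards [hUv'] with ξ hξ
  rw [hξ, hg]
  simp only [mulVec_mulVec, Matrix.mul_nonsing_inv _ hdet, one_mulVec]
  abel

end Closed
/-- On `I = (0, b)` with the standing port-Hamiltonian assumptions, the
operator `A x = P₁(𝓗x)' + P₀𝓗x` with Dirichlet boundary conditions `(𝓗x)(0) = (𝓗x)(b) = 0`
is densely defined and closed in `L²_𝓗(0, b)`, and its adjoint is
`A* x = −P₁(𝓗x)' − P₀𝓗x` with domain `{x : (𝓗x)' ∈ L²_𝓗(0, b)}` (no boundary conditions);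
the adjoint is described through its graph: `(y, z)` is in the graph of `A*` iff
`⟨A x, y⟩_{L²_𝓗} = ⟨x, z⟩_{L²_𝓗}` for all `x ∈ D(A)`. -/
theorem stmt_10 (d : ℕ) (hd : 1 ≤ d) (b : ℝ) (hb : 0 < b)
    (𝓗 : ℝ → Matrix (Fin d) (Fin d) ℂ)
    (hmeas : ∀ i j, AEMeasurable (fun ξ => 𝓗 ξ i j) (volume.restrict (Set.Ioo 0 b)))
    (hherm : ∀ᵐ ξ ∂(volume.restrict (Set.Ioo 0 b)), (𝓗 ξ).IsHermitian)
    (hbnd : ∃ m M : ℝ, 0 < m ∧ 0 < M ∧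
      ∀ᵐ ξ ∂(volume.restrict (Set.Ioo 0 b)), ∀ ζ : Fin d → ℂ,
        m * (star ζ ⬝ᵥ ζ).re ≤ (star ζ ⬝ᵥ ((𝓗 ξ) *ᵥ ζ)).re ∧
          (star ζ ⬝ᵥ ((𝓗 ξ) *ᵥ ζ)).re ≤ M * (star ζ ⬝ᵥ ζ).re)
    (P1 P0 : Matrix (Fin d) (Fin d) ℂ)
    (hP1 : P1.IsHermitian) (hP1inv : IsUnit P1) (hP0 : P0.conjTranspose = -P0) :
    -- `A` is densely defined
    (∀ z : ℝ → Fin d → ℂ, MemL2w d 𝓗 (Set.Ioo 0 b) z → ∀ ε : ℝ, 0 < ε →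
      ∃ x y, GraphA10 d 𝓗 P1 P0 b x y ∧
        (wip d 𝓗 (Set.Ioo 0 b) (fun ξ => x ξ - z ξ) (fun ξ => x ξ - z ξ)).re < ε) ∧
    -- `A` is closed
    (∀ (xs ys : ℕ → ℝ → Fin d → ℂ) (x y : ℝ → Fin d → ℂ),
      (∀ n, GraphA10 d 𝓗 P1 P0 b (xs n) (ys n)) →
      MemL2w d 𝓗 (Set.Ioo 0 b) x → MemL2w d 𝓗 (Set.Ioo 0 b) y →
      Filter.Tendsto (fun n =>
        (wip d 𝓗 (Set.Ioo 0 b) (fun ξ => xs n ξ - x ξ) (fun ξ => xs n ξ - x ξ)).re)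
        Filter.atTop (nhds 0) →
      Filter.Tendsto (fun n =>
        (wip d 𝓗 (Set.Ioo 0 b) (fun ξ => ys n ξ - y ξ) (fun ξ => ys n ξ - y ξ)).re)
        Filter.atTop (nhds 0) →
      GraphA10 d 𝓗 P1 P0 b x y) ∧
    -- the adjoint of `A` is `−P₁(𝓗·)' − P₀𝓗·` on `{y : (𝓗y)' ∈ L²_𝓗}`
    (∀ y z : ℝ → Fin d → ℂ,
      MemL2w d 𝓗 (Set.Ioo 0 b) y → MemL2w d 𝓗 (Set.Ioo 0 b) z →
      ((∀ x w, GraphA10 d 𝓗 P1 P0 b x w →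
          wip d 𝓗 (Set.Ioo 0 b) w y = wip d 𝓗 (Set.Ioo 0 b) x z) ↔
        ∃ u g, RepOn d 𝓗 b y u g ∧
          (∀ᵐ ξ ∂(volume.restrict (Set.Ioo 0 b)),
            z ξ = -(P1 *ᵥ (g ξ)) - P0 *ᵥ (u ξ)))) := by
  obtain ⟨m, M, hm, hM, hmM⟩ := hbnd
  have h := aestronglyMeasurable_matrix hmeas
  have hH : ∀ᵐ ξ ∂(volume.restrict (Set.Ioo 0 b)), FormBounded m M (𝓗 ξ) := by
    filter_upwards [hherm, hmM] with ξ h1 h2 using ⟨h1, h2⟩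
  refine ⟨fun z hz ε hε => ?_, fun xs ys x y hgr hx hy hxs hys =>
    graphA10_of_tendsto hb hm hM h hH hP1inv hgr hx hy hxs hys, fun y z hy hz =>
    exists_repOn_iff hb hm hM h hH hP1 hP1inv hP0 hy hz⟩
  have zL := (memL2w_iff hm hM h hH).1 hz
  have hd' : (0 : ℝ) < d := by exact_mod_cast hd
  obtain ⟨u, g, hg, hu0, hub, hu, huz⟩ := exists_primitive_integral_sq_norm_sub_lt hb
    (memLp_mulVec hm hM h hH zL) (ε := m * ε / d) (by positivity)
  have hgr := graphA10_inv_mulVec (P1 := P1) (P0 := P0) hb.le hm hM h hH hg hu hu0 hub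
  refine ⟨_, _, hgr, ?_⟩
  have h1 := re_wip_le_mul_integral_sq_norm hm hM h hH
    (((memL2w_iff hm hM h hH).1 hgr.1).sub zL)
  have h2 : ∫ ξ in Set.Ioo 0 b, ‖𝓗 ξ *ᵥ ((𝓗 ξ)⁻¹ *ᵥ u ξ - z ξ)‖ ^ 2
      = ∫ ξ in Set.Ioo 0 b, ‖u ξ - 𝓗 ξ *ᵥ z ξ‖ ^ 2 := by
    refine integral_congr_ae ?_
    filter_upwards [hH] with ξ hξ
    rw [mulVec_sub, hξ.mulVec_inv hm]
  refine lt_of_le_of_lt h1 ?_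
  simp only [Pi.sub_apply]
  rw [h2]
  calc m⁻¹ * d * ∫ ξ in Set.Ioo 0 b, ‖u ξ - 𝓗 ξ *ᵥ z ξ‖ ^ 2 < m⁻¹ * d * (m * ε / d) := by
        gcongr
    _ = ε := by field_simp
end

section
/- Let 𝓗 be as in the standing port-Hamiltonian assumptions on I = [0, ∞). Let x ∈ L²_𝓗(0, ∞) be such that (𝓗x)' ∈ L²_𝓗(0, ∞), and let u denote the continuous representative of 𝓗x. Then: (a) u is bounded on [0, ∞); (b) if in addition ess sup_{ξ ∈ (0,∞)} ‖𝓗(ξ)‖ < ∞, then u(ξ) → 0 as ξ → ∞. -/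
open MeasureTheory Matrix

/-- Square of a primitive of an interval-integrable function. -/
theorem sq_primitive_eq {f g : ℝ → ℝ} {b : ℝ} (hb : 0 ≤ b)
    (hg : IntervalIntegrable g volume 0 b)
    (hf : ∀ t ∈ Set.Icc 0 b, f t = f 0 + ∫ τ in (0 : ℝ)..t, g τ) :
    IntervalIntegrable (fun t => 2 * (f t * g t)) volume 0 b ∧
      f b ^ 2 = f 0 ^ 2 + ∫ t in (0 : ℝ)..b, 2 * (f t * g t) := by
  have hac := hg.absolutelyContinuousOnInterval_intervalIntegral (c := 0) (by simp)
  have hF : AbsolutelyContinuousOnInterval (fun t => f 0 + ∫ τ in (0 : ℝ)..t, g τ) 0 b :=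
    ((LipschitzWith.const (f 0)).lipschitzOnWith (s := Set.uIcc 0 b)
      ).absolutelyContinuousOnInterval.fun_add hac
  have hFcont := hF.continuousOn
  rw [Set.uIcc_of_le hb] at hFcont
  have hfcont : ContinuousOn f (Set.uIcc 0 b) := by
    rw [Set.uIcc_of_le hb]
    exact hFcont.congr hf
  have hint : IntervalIntegrable (fun t => f t * g t) volume 0 b :=
    hg.continuousOn_mul hfcont
  refine ⟨hint.const_mul 2, ?_⟩
  have key := hF.integral_deriv_mul_eq_sub hF
  rw [intervalIntegral.integral_congr_ae (g := fun t => 2 * (f t * g t))] at key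
  · simp only [← hf b ⟨hb, le_rfl⟩, intervalIntegral.integral_same, add_zero] at key
    linarith
  · filter_upwards [hg.ae_hasDerivAt_integral] with t ht htm
    rw [((ht (Set.uIoc_subset_uIcc htm) 0 (by simp)).const_add (f 0)).deriv]
    rw [Set.uIoc_of_le hb] at htm
    rw [← hf t ⟨htm.1.le, htm.2⟩]
    ring

/-- A function on `[0, ∞)` that is the primitive of an integrable function is bounded; if it is
itself integrable, it tends to `0` at infinity. -/
theorem bounded_and_tendsto_zero_of_primitive {N h : ℝ → ℝ}
    (hh : IntegrableOn h (Set.Ioi 0))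
    (hN : ∀ t, 0 ≤ t → N t = N 0 + ∫ τ in (0 : ℝ)..t, h τ) :
    (∃ C, ∀ t, 0 ≤ t → N t ≤ C) ∧
      (IntegrableOn N (Set.Ioi 0) → Filter.Tendsto N Filter.atTop (nhds 0)) := by
  constructor
  · refine ⟨N 0 + ∫ τ in Set.Ioi 0, ‖h τ‖, fun t ht => ?_⟩
    rw [hN t ht]
    have h1 : ∫ τ in (0 : ℝ)..t, h τ ≤ ∫ τ in Set.Ioc 0 t, ‖h τ‖ := by
      rw [intervalIntegral.integral_of_le ht]
      exact (Real.le_norm_self _).trans (norm_integral_le_integral_norm _)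
    have h2 : ∫ τ in Set.Ioc 0 t, ‖h τ‖ ≤ ∫ τ in Set.Ioi 0, ‖h τ‖ :=
      setIntegral_mono_set hh.norm (Filter.Eventually.of_forall fun _ => norm_nonneg _)
        Set.Ioc_subset_Ioi_self.eventuallyLE
    linarith
  · intro hNi
    have hlim : Filter.Tendsto N Filter.atTop (nhds (N 0 + ∫ τ in Set.Ioi 0, h τ)) := by
      refine ((intervalIntegral_tendsto_integral_Ioi 0 hh Filter.tendsto_id).const_add
        (N 0)).congr' ?_
      filter_upwards [Filter.eventually_ge_atTop 0] with t ht
      exact (hN t ht).symm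
    generalize N 0 + ∫ τ in Set.Ioi 0, h τ = L at hlim
    suffices hL : L = 0 by rwa [hL] at hlim
    by_contra hL
    have hev : ∀ᶠ t in Filter.atTop, |L| / 2 < |N t| :=
      hlim.abs.eventually_const_lt (half_lt_self (abs_pos.2 hL))
    obtain ⟨R, hR⟩ := (hev.and (Filter.eventually_gt_atTop 0)).exists_forall_of_atTop
    have hc : IntegrableOn (fun _ : ℝ => |L| / 2) (Set.Ioi R) := by
      refine Integrable.mono' (hNi.mono_set (Set.Ioi_subset_Ioi (hR R le_rfl).2.le)).norm
        aestronglyMeasurable_const ?_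
      filter_upwards [ae_restrict_mem measurableSet_Ioi] with t ht
      rw [Real.norm_eq_abs, abs_of_nonneg (by positivity)]
      exact (hR t (le_of_lt ht)).1.le
    rw [integrableOn_const_iff] at hc
    simp [hL] at hc

theorem re_dotProduct_mulVec_add_smul {d : ℕ} {A : Matrix (Fin d) (Fin d) ℂ}
    (hA : A.IsHermitian) (x y : Fin d → ℂ) (t : ℝ) :
    (star (x + (t : ℂ) • y) ⬝ᵥ (A *ᵥ (x + (t : ℂ) • y))).re =
      (star x ⬝ᵥ (A *ᵥ x)).re + 2 * t * (star (A *ᵥ x) ⬝ᵥ y).re +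
        t ^ 2 * (star y ⬝ᵥ (A *ᵥ y)).re := by
  have h1 : star x ⬝ᵥ (A *ᵥ y) = star (A *ᵥ x) ⬝ᵥ y := by
    rw [star_mulVec, hA.eq, dotProduct_mulVec]
  have h2 : (star y ⬝ᵥ (A *ᵥ x)).re = (star (A *ᵥ x) ⬝ᵥ y).re := by
    rw [star_dotProduct, Complex.star_def, Complex.conj_re]
  simp only [star_add, star_smul, mulVec_add, mulVec_smul, add_dotProduct, dotProduct_add,
    smul_dotProduct, dotProduct_smul, smul_eq_mul, h1, Complex.add_re, Complex.mul_re,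
    Complex.star_def, Complex.conj_ofReal, Complex.ofReal_re, Complex.ofReal_im, h2]
  ring

theorem abs_two_re_dotProduct_le {d : ℕ} {A : Matrix (Fin d) (Fin d) ℂ}
    (hA : A.IsHermitian) (hpos : ∀ ζ : Fin d → ℂ, 0 ≤ (star ζ ⬝ᵥ (A *ᵥ ζ)).re)
    (x y : Fin d → ℂ) :
    |2 * (star (A *ᵥ x) ⬝ᵥ y).re| ≤
      (star x ⬝ᵥ (A *ᵥ x)).re + (star y ⬝ᵥ (A *ᵥ y)).re := by
  have h1 := hpos (x + ((1 : ℝ) : ℂ) • y)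
  have h2 := hpos (x + ((-1 : ℝ) : ℂ) • y)
  rw [re_dotProduct_mulVec_add_smul hA] at h1 h2
  rw [abs_le]
  constructor <;> linarith

theorem re_star_mulVec_self_le {d : ℕ} {A : Matrix (Fin d) (Fin d) ℂ}
    (hA : A.IsHermitian) (hpos : ∀ ζ : Fin d → ℂ, 0 ≤ (star ζ ⬝ᵥ (A *ᵥ ζ)).re)
    {M : ℝ} (hM : 0 < M)
    (hle : ∀ ζ : Fin d → ℂ, (star ζ ⬝ᵥ (A *ᵥ ζ)).re ≤ M * (star ζ ⬝ᵥ ζ).re)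
    (x : Fin d → ℂ) :
    (star (A *ᵥ x) ⬝ᵥ (A *ᵥ x)).re ≤ M * (star x ⬝ᵥ (A *ᵥ x)).re := by
  have h1 := hpos (x + ((-M⁻¹ : ℝ) : ℂ) • (A *ᵥ x))
  rw [re_dotProduct_mulVec_add_smul hA] at h1
  have h2 := mul_le_mul_of_nonneg_left (hle (A *ᵥ x)) (sq_nonneg M⁻¹)
  have h3 : 0 ≤ (star x ⬝ᵥ (A *ᵥ x)).re - M⁻¹ * (star (A *ᵥ x) ⬝ᵥ (A *ᵥ x)).re := by
    have h4 : M⁻¹ ^ 2 * (M * (star (A *ᵥ x) ⬝ᵥ (A *ᵥ x)).re) =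
        M⁻¹ * (star (A *ᵥ x) ⬝ᵥ (A *ᵥ x)).re := by
      field_simp
    nlinarith
  have h5 := mul_nonneg hM.le h3
  rw [mul_sub, ← mul_assoc, mul_inv_cancel₀ hM.ne', one_mul] at h5
  linarith

theorem re_star_dotProduct_eq_sum {d : ℕ} (v w : Fin d → ℂ) :
    (star v ⬝ᵥ w).re = ∑ i, ((v i).re * (w i).re + (v i).im * (w i).im) := by
  simp [dotProduct, Complex.mul_re]

theorem norm_sq_le_re_star_dotProduct_self {d : ℕ} (v : Fin d → ℂ) :
    ‖v‖ ^ 2 ≤ (star v ⬝ᵥ v).re := by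
  have h0 : ∀ i, 0 ≤ (v i).re * (v i).re + (v i).im * (v i).im := fun i =>
    add_nonneg (mul_self_nonneg _) (mul_self_nonneg _)
  rw [re_star_dotProduct_eq_sum]
  have hs := Finset.sum_nonneg fun i (_ : i ∈ Finset.univ) => h0 i
  rw [← Real.le_sqrt (norm_nonneg _) hs, pi_norm_le_iff_of_nonneg (Real.sqrt_nonneg _)]
  intro i
  refine Real.le_sqrt_of_sq_le ?_
  rw [Complex.sq_norm, Complex.normSq_apply]
  exact Finset.single_le_sum (f := fun i => (v i).re * (v i).re + (v i).im * (v i).im)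
    (fun i _ => h0 i) (Finset.mem_univ i)

theorem MeasureTheory.AEStronglyMeasurable.re_star_dotProduct {α : Type*} [MeasurableSpace α]
    {μ : Measure α} {d : ℕ} {v w : α → Fin d → ℂ} (hv : AEStronglyMeasurable v μ)
    (hw : AEStronglyMeasurable w μ) :
    AEStronglyMeasurable (fun t => (star (v t) ⬝ᵥ w t).re) μ := by
  have hcont : Continuous (Function.uncurry fun p q : Fin d → ℂ => (star p ⬝ᵥ q).re) := by
    simp only [Function.uncurry_def, re_star_dotProduct_eq_sum]
    fun_prop
  exact hcont.comp_aestronglyMeasurable₂ hv hw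

/-- Energy identity for the primitive `u` of an interval-integrable vector-valued function. -/
theorem re_star_dotProduct_self_primitive {d : ℕ} {u g : ℝ → Fin d → ℂ} {b : ℝ} (hb : 0 ≤ b)
    (hg : IntervalIntegrable g volume 0 b)
    (hu : ∀ t ∈ Set.Icc 0 b, u t = u 0 + ∫ τ in (0 : ℝ)..t, g τ) :
    (star (u b) ⬝ᵥ u b).re =
      (star (u 0) ⬝ᵥ u 0).re + ∫ t in (0 : ℝ)..b, 2 * (star (u t) ⬝ᵥ g t).re := by
  have hL : ∀ L : (Fin d → ℂ) →L[ℝ] ℝ,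
      IntervalIntegrable (fun t => 2 * (L (u t) * L (g t))) volume 0 b ∧
        L (u b) ^ 2 = L (u 0) ^ 2 + ∫ t in (0 : ℝ)..b, 2 * (L (u t) * L (g t)) := by
    intro L
    refine sq_primitive_eq (f := fun t => L (u t)) (g := fun t => L (g t)) hb
      ⟨L.integrable_comp hg.1, L.integrable_comp hg.2⟩ fun t ht => ?_
    have hgt : IntervalIntegrable g volume 0 t := hg.mono_set (by
      rw [Set.uIcc_of_le ht.1, Set.uIcc_of_le hb]
      exact Set.Icc_subset_Icc_right ht.2)
    rw [L.intervalIntegral_comp_comm hgt, ← map_add, ← hu t ht]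
  have hre := fun i : Fin d => hL (Complex.reCLM.comp (ContinuousLinearMap.proj i))
  have him := fun i : Fin d => hL (Complex.imCLM.comp (ContinuousLinearMap.proj i))
  simp only [ContinuousLinearMap.comp_apply, ContinuousLinearMap.proj_apply, Complex.reCLM_apply,
    Complex.imCLM_apply] at hre him
  simp only [re_star_dotProduct_eq_sum, Finset.mul_sum, mul_add]
  rw [intervalIntegral.integral_finsetSum fun i _ => (hre i).1.add (him i).1,
    ← Finset.sum_add_distrib]
  refine Finset.sum_congr rfl fun i _ => ?_
  rw [intervalIntegral.integral_add (hre i).1 (him i).1]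
  have h1 := (hre i).2
  have h2 := (him i).2
  linarith

/-- **weighted Barbălat-type lemma.** Let `𝓗` satisfy the standing
port-Hamiltonian assumptions on `I = [0, ∞)` (measurable entries, a.e. Hermitian, locally
bounded above and below by positive multiples of the identity).  Let `x ∈ L²_𝓗(0, ∞)` be
such that `(𝓗x)' ∈ L²_𝓗(0, ∞)`, i.e. `𝓗x` has a locally absolutely continuous
representative `u` (the indefinite integral of some `g ∈ L²_𝓗(0, ∞)`).  Then
(a) `u` is bounded on `[0, ∞)`; and
(b) if in addition `𝓗` is essentially bounded, then `u(ξ) → 0` as `ξ → ∞`. -/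
theorem stmt_11 (d : ℕ) (hd : 1 ≤ d) (𝓗 : ℝ → Matrix (Fin d) (Fin d) ℂ)
    (hmeas : ∀ i j, AEMeasurable (fun ξ => 𝓗 ξ i j) (volume.restrict (Set.Ioi (0 : ℝ))))
    (hherm : ∀ᵐ ξ ∂(volume.restrict (Set.Ioi (0 : ℝ))), (𝓗 ξ).IsHermitian)
    (hloc : ∀ K : Set ℝ, Bornology.IsBounded K → ∃ m M : ℝ, 0 < m ∧ 0 < M ∧
      ∀ᵐ ξ ∂(volume.restrict (K ∩ Set.Ioi 0)), ∀ ζ : Fin d → ℂ,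
        m * (star ζ ⬝ᵥ ζ).re ≤ (star ζ ⬝ᵥ ((𝓗 ξ) *ᵥ ζ)).re ∧
          (star ζ ⬝ᵥ ((𝓗 ξ) *ᵥ ζ)).re ≤ M * (star ζ ⬝ᵥ ζ).re)
    (x u g : ℝ → Fin d → ℂ)
    (hx : MemL2w d 𝓗 (Set.Ioi 0) x)
    (hu : ∀ᵐ ξ ∂(volume.restrict (Set.Ioi (0 : ℝ))), u ξ = (𝓗 ξ) *ᵥ (x ξ))
    (huint : ∀ ξ ∈ Set.Ici (0 : ℝ), u ξ = u 0 + ∫ τ in (0 : ℝ)..ξ, g τ)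
    (hg : MemL2w d 𝓗 (Set.Ioi 0) g) :
    (∃ C : ℝ, ∀ ξ ∈ Set.Ici (0 : ℝ), ‖u ξ‖ ≤ C) ∧
      ((∃ M : ℝ, ∀ᵐ ξ ∂(volume.restrict (Set.Ioi (0 : ℝ))), ∀ ζ : Fin d → ℂ,
          (star ζ ⬝ᵥ ((𝓗 ξ) *ᵥ ζ)).re ≤ M * (star ζ ⬝ᵥ ζ).re) →
        Filter.Tendsto u Filter.atTop (nhds 0)) := by
  have hform : ∀ᵐ ξ ∂(volume.restrict (Set.Ioi (0 : ℝ))), ∀ ζ : Fin d → ℂ,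
      0 ≤ (star ζ ⬝ᵥ ((𝓗 ξ) *ᵥ ζ)).re := by
    have hn : ∀ n : ℕ, ∀ᵐ ξ ∂volume, ξ ∈ Set.Icc (0 : ℝ) n ∩ Set.Ioi 0 →
        ∀ ζ : Fin d → ℂ, 0 ≤ (star ζ ⬝ᵥ ((𝓗 ξ) *ᵥ ζ)).re := by
      intro n
      obtain ⟨m, M, hm, -, h⟩ := hloc (Set.Icc 0 n) (Metric.isBounded_Icc _ _)
      rw [ae_restrict_iff' (measurableSet_Icc.inter measurableSet_Ioi)] at h
      filter_upwards [h] with ξ hξ hmem ζ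
      exact (mul_nonneg hm.le ((sq_nonneg _).trans
        (norm_sq_le_re_star_dotProduct_self ζ))).trans (hξ hmem ζ).1
    rw [ae_restrict_iff' measurableSet_Ioi]
    filter_upwards [ae_all_iff.2 hn] with ξ hξ hpos
    obtain ⟨n, hn⟩ := exists_nat_ge ξ
    exact hξ n ⟨⟨le_of_lt hpos, hn⟩, hpos⟩
  have hgint : ∀ b : ℝ, 0 ≤ b → IntervalIntegrable g volume 0 b := by
    intro b hb
    rw [intervalIntegrable_iff_integrableOn_Ioc_of_le hb]
    obtain ⟨m, M, hm, -, h⟩ := hloc (Set.Ioc 0 b) (Metric.isBounded_Ioc _ _)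
    rw [Set.inter_eq_left.2 Set.Ioc_subset_Ioi_self] at h
    have hint : IntegrableOn (fun ξ => 1 + m⁻¹ * (star (g ξ) ⬝ᵥ ((𝓗 ξ) *ᵥ (g ξ))).re)
        (Set.Ioc 0 b) :=
      (integrableOn_const (by simp)).add
        ((hg.2.mono_measure (Measure.restrict_mono Set.Ioc_subset_Ioi_self le_rfl)).const_mul _)
    refine Integrable.mono' hint
      (hg.1.mono_measure (Measure.restrict_mono Set.Ioc_subset_Ioi_self le_rfl)) ?_
    filter_upwards [h] with ξ hξ
    have h1 := (mul_le_mul_of_nonneg_left (norm_sq_le_re_star_dotProduct_self (g ξ)) hm.le).trans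
      (hξ (g ξ)).1
    have h2 := mul_le_mul_of_nonneg_left h1 (inv_nonneg.2 hm.le)
    rw [← mul_assoc, inv_mul_cancel₀ hm.ne', one_mul] at h2
    nlinarith [sq_nonneg (‖g ξ‖ - 1), norm_nonneg (g ξ)]
  have hucont : ContinuousOn u (Set.Ioi 0) := by
    intro t ht
    have h1 : ContinuousOn (fun s => u 0 + ∫ τ in (0 : ℝ)..s, g τ) (Set.uIcc 0 (t + 1)) :=
      continuousOn_const.add (intervalIntegral.continuousOn_primitive_interval'
        (hgint (t + 1) (by linarith [Set.mem_Ioi.1 ht])) (by simp))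
    rw [Set.uIcc_of_le (by linarith [Set.mem_Ioi.1 ht])] at h1
    have h2 : ContinuousOn u (Set.Icc 0 (t + 1)) := h1.congr fun s hs => huint s hs.1
    exact (h2.continuousAt (Icc_mem_nhds ht (by linarith))).continuousWithinAt
  have humeas : AEStronglyMeasurable u (volume.restrict (Set.Ioi 0)) :=
    hucont.aestronglyMeasurable measurableSet_Ioi
  have hre_meas := fun {w : ℝ → Fin d → ℂ}
    (hw : AEStronglyMeasurable w (volume.restrict (Set.Ioi 0))) =>
      humeas.re_star_dotProduct hw
  have hh : IntegrableOn (fun t => 2 * (star (u t) ⬝ᵥ g t).re) (Set.Ioi 0) := by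
    refine Integrable.mono' (hx.2.add hg.2) ((hre_meas hg.1).const_mul 2) ?_
    filter_upwards [hform, hherm, hu] with ξ hpos hA huξ
    rw [huξ]
    exact abs_two_re_dotProduct_le hA hpos (x ξ) (g ξ)
  have henergy : ∀ t, 0 ≤ t → (star (u t) ⬝ᵥ u t).re =
      (star (u 0) ⬝ᵥ u 0).re + ∫ τ in (0 : ℝ)..t, 2 * (star (u τ) ⬝ᵥ g τ).re := fun t ht =>
    re_star_dotProduct_self_primitive ht (hgint t ht) fun s hs => huint s hs.1
  obtain ⟨⟨C, hC⟩, hlim⟩ := bounded_and_tendsto_zero_of_primitive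
    (N := fun t => (star (u t) ⬝ᵥ u t).re) hh henergy
  refine ⟨⟨Real.sqrt C, fun t ht => Real.le_sqrt_of_sq_le
    ((norm_sq_le_re_star_dotProduct_self _).trans (hC t ht))⟩, ?_⟩
  rintro ⟨M, hM⟩
  have hN : IntegrableOn (fun t => (star (u t) ⬝ᵥ u t).re) (Set.Ioi 0) := by
    refine Integrable.mono' (hx.2.const_mul (max M 1)) (hre_meas humeas) ?_
    filter_upwards [hform, hherm, hu, hM] with ξ hpos hA huξ hMξ
    rw [Real.norm_of_nonneg ((sq_nonneg _).trans (norm_sq_le_re_star_dotProduct_self _)), huξ]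
    refine re_star_mulVec_self_le hA hpos (by positivity) (fun ζ => (hMξ ζ).trans ?_) (x ξ)
    exact mul_le_mul_of_nonneg_right (le_max_left _ _)
      ((sq_nonneg _).trans (norm_sq_le_re_star_dotProduct_self _))
  have hsqrt := (hlim hN).sqrt
  rw [Real.sqrt_zero] at hsqrt
  exact squeeze_zero_norm
    (fun t => Real.le_sqrt_of_sq_le (norm_sq_le_re_star_dotProduct_self _)) hsqrt
end
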